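/- arXiv:2208.05709 — 2 statements merged into one kernel-verified Lean document; each statement's English description precedes it below -/
import Mathlib

section
/- Let d ≥ 1, let Ω ⊆ ℝ^d be open, and let K : Ω → Sym_d(ℝ) be a continuous field of symmetric d×d real matrices. For a locally Lipschitz U : Ω → ℝ and a measurable field ν : Ω → ℝ^d with ‖ν(x)‖ = 1 almost everywhere, set B_{U,ν}(x) := √(‖∇U(x)‖² + (tr K(x) − ⟨ν(x), K(x)ν(x)⟩)²). Suppose (U_i, ν_i), i ∈ ℕ, are pairs such that each U_i : Ω → ℝ is a weak solution with bulk term B_{U_i,ν_i} on Ω, and suppose: (a) U_i → U locally uniformly on Ω, and for every compact A ⊆ Ω there is a constant L(A) such that every U_i is L(A)-Lipschitz on A; (b) ν_i → ν pointwise almost everywhere on Ω, where ν : Ω → ℝ^d is measurable with ‖ν(x)‖ = 1 almost everywhere; (c) ‖∇U_i‖ → ‖∇U‖ in L¹_loc(Ω). Then U is locally Lipschitz and U is a weak solution with bulk term B_{U,ν} on Ω. -/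
open MeasureTheory Set Filter Topology
noncomputable section

/-- Euclidean space `ℝ^m`. -/
abbrev Euc (m : ℕ) : Type := EuclideanSpace ℝ (Fin m)

/-- `f` is locally Lipschitz on `Ω`: Lipschitz on every compact subset of `Ω`. -/
def LocLipOn {m : ℕ} (Ω : Set (Euc m)) (f : Euc m → ℝ) : Prop :=
  ∀ A : Set (Euc m), IsCompact A → A ⊆ Ω → ∃ L : NNReal, LipschitzOnWith L f A

/-- The functional `J_B^A(v) = ∫_A (‖∇v‖ + v·B)`, with the gradient understood via
`fderiv` (which is `0` at points of non-differentiability). -/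
noncomputable def Jfun {m : ℕ} (B : Euc m → ℝ) (A : Set (Euc m)) (v : Euc m → ℝ) : ℝ :=
  ∫ x in A, (‖gradient v x‖ + v x * B x)

/-- `u` is a weak solution with bulk term `B` on `Ω`: it minimizes `J_B^A` among all
locally Lipschitz competitors differing from `u` inside the interior of a compact `A ⊆ Ω`. -/
def IsWeakSol {m : ℕ} (Ω : Set (Euc m)) (B : Euc m → ℝ) (u : Euc m → ℝ) : Prop :=
  ∀ A : Set (Euc m), IsCompact A → A ⊆ Ω →
    ∀ v : Euc m → ℝ, LocLipOn Ω v → {x | v x ≠ u x} ⊆ interior A →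
      Jfun B A u ≤ Jfun B A v

/-- `P_ν = tr K − ⟨ν, Kν⟩`, the trace of `K` orthogonal to the unit vector field `ν`. -/
noncomputable def Pnu {m : ℕ} (K : Euc m → Matrix (Fin m) (Fin m) ℝ)
    (ν : Euc m → Euc m) (x : Euc m) : ℝ :=
  (K x).trace - ∑ i, ∑ j, ν x i * K x i j * ν x j

/-- The frozen bulk term `B_{u,ν} = √(‖∇u‖² + P_ν²)`. -/
noncomputable def Bulk {m : ℕ} (K : Euc m → Matrix (Fin m) (Fin m) ℝ)
    (u : Euc m → ℝ) (ν : Euc m → Euc m) (x : Euc m) : ℝ :=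
  Real.sqrt (‖gradient u x‖ ^ 2 + Pnu K ν x ^ 2)

theorem norm_gradient_eq_norm_fderiv {m : ℕ} (f : Euc m → ℝ) (x : Euc m) :
    ‖gradient f x‖ = ‖fderiv ℝ f x‖ := by
  simp [gradient]

theorem measurable_norm_gradient {m : ℕ} (f : Euc m → ℝ) :
    Measurable fun x => ‖gradient f x‖ := by
  simp_rw [norm_gradient_eq_norm_fderiv]
  exact (measurable_fderiv ℝ f).norm

theorem norm_gradient_le_of_lipschitzOn {m : ℕ} {f : Euc m → ℝ} {s : Set (Euc m)} {L : NNReal}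
    (hf : LipschitzOnWith L f s) {x : Euc m} (hx : s ∈ 𝓝 x) : ‖gradient f x‖ ≤ L := by
  rw [norm_gradient_eq_norm_fderiv]
  exact norm_fderiv_le_of_lipschitzOn ℝ hx hf

theorem ae_differentiableAt_of_lipschitzOn {m : ℕ} {f : Euc m → ℝ} {s t : Set (Euc m)}
    {L : NNReal} (hf : LipschitzOnWith L f s) (hts : ∀ x ∈ t, s ∈ 𝓝 x) :
    ∀ᵐ x : Euc m, x ∈ t → DifferentiableAt ℝ f x := by
  filter_upwards [hf.ae_differentiableWithinAt_of_mem] with x hx hxt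
  exact (hx (mem_of_mem_nhds (hts x hxt))).differentiableAt (hts x hxt)

namespace LocLipOn

variable {m : ℕ} {Ω A : Set (Euc m)} {f g : Euc m → ℝ}

theorem continuousOn (hf : LocLipOn Ω f) (hA : IsCompact A) (hAΩ : A ⊆ Ω) :
    ContinuousOn f A := by
  obtain ⟨L, hL⟩ := hf A hA hAΩ
  exact hL.continuousOn

theorem exists_abs_le (hf : LocLipOn Ω f) (hA : IsCompact A) (hAΩ : A ⊆ Ω) :
    ∃ C, 0 ≤ C ∧ ∀ x ∈ A, |f x| ≤ C := by
  obtain ⟨C, hC⟩ := hA.exists_bound_of_continuousOn (hf.continuousOn hA hAΩ)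
  exact ⟨max C 0, le_max_right _ _, fun x hx => (hC x hx).trans (le_max_left _ _)⟩

theorem add (hf : LocLipOn Ω f) (hg : LocLipOn Ω g) : LocLipOn Ω fun x => f x + g x := by
  intro A hA hAΩ
  obtain ⟨L, hL⟩ := hf A hA hAΩ
  obtain ⟨M, hM⟩ := hg A hA hAΩ
  exact ⟨L + M, hL.add hM⟩

theorem sub (hf : LocLipOn Ω f) (hg : LocLipOn Ω g) : LocLipOn Ω fun x => f x - g x := by
  intro A hA hAΩ
  obtain ⟨L, hL⟩ := hf A hA hAΩ
  obtain ⟨M, hM⟩ := hg A hA hAΩ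
  exact ⟨L + M, hL.sub hM⟩

theorem mul (hf : LocLipOn Ω f) (hg : LocLipOn Ω g) : LocLipOn Ω fun x => f x * g x := by
  intro A hA hAΩ
  obtain ⟨L, hL⟩ := hf A hA hAΩ
  obtain ⟨M, hM⟩ := hg A hA hAΩ
  obtain ⟨C, hC0, hC⟩ := hf.exists_abs_le hA hAΩ
  obtain ⟨D, hD0, hD⟩ := hg.exists_abs_le hA hAΩ
  lift C to NNReal using hC0
  lift D to NNReal using hD0
  refine ⟨C * M + D * L, LipschitzOnWith.of_dist_le_mul fun x hx y hy => ?_⟩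
  have h₁ := hL.dist_le_mul x hx y hy
  have h₂ := hM.dist_le_mul x hx y hy
  rw [Real.dist_eq] at h₁ h₂ ⊢
  calc |f x * g x - f y * g y| = |f x * (g x - g y) + g y * (f x - f y)| := by ring_nf
    _ ≤ |f x| * |g x - g y| + |g y| * |f x - f y| := by
      simpa only [abs_mul] using abs_add_le (f x * (g x - g y)) (g y * (f x - f y))
    _ ≤ C * (M * dist x y) + D * (L * dist x y) := by
      gcongr
      · exact hC x hx
      · exact hD y hy
    _ = _ := by push_cast; ring

theorem exists_norm_gradient_le (hΩ : IsOpen Ω) (hf : LocLipOn Ω f) (hA : IsCompact A)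
    (hAΩ : A ⊆ Ω) : ∃ C : NNReal, ∀ x ∈ A, ‖gradient f x‖ ≤ C := by
  obtain ⟨A', hA', hAA', hA'Ω⟩ := exists_compact_between hA hΩ hAΩ
  obtain ⟨L, hL⟩ := hf A' hA' hA'Ω
  exact ⟨L, fun x hx => norm_gradient_le_of_lipschitzOn hL (mem_interior_iff_mem_nhds.1 (hAA' hx))⟩

theorem ae_differentiableAt (hΩ : IsOpen Ω) (hf : LocLipOn Ω f) (hA : IsCompact A)
    (hAΩ : A ⊆ Ω) : ∀ᵐ x : Euc m, x ∈ A → DifferentiableAt ℝ f x := by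
  obtain ⟨A', hA', hAA', hA'Ω⟩ := exists_compact_between hA hΩ hAΩ
  obtain ⟨L, hL⟩ := hf A' hA' hA'Ω
  exact ae_differentiableAt_of_lipschitzOn hL fun x hx => mem_interior_iff_mem_nhds.1 (hAA' hx)

theorem aestronglyMeasurable (hf : LocLipOn Ω f) (hA : IsCompact A) (hAΩ : A ⊆ Ω) :
    AEStronglyMeasurable f (volume.restrict A) :=
  (hf.continuousOn hA hAΩ).aestronglyMeasurable hA.measurableSet

theorem of_tendsto {F : ℕ → Euc m → ℝ} (hF : ∀ x ∈ Ω, Tendsto (fun i => F i x) atTop (𝓝 (f x)))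
    (hL : ∀ A : Set (Euc m), IsCompact A → A ⊆ Ω → ∃ L : NNReal, ∀ i, LipschitzOnWith L (F i) A) :
    LocLipOn Ω f := by
  intro A hA hAΩ
  obtain ⟨L, hL⟩ := hL A hA hAΩ
  refine ⟨L, LipschitzOnWith.of_dist_le_mul fun x hx y hy => ?_⟩
  exact le_of_tendsto ((hF x (hAΩ hx)).dist (hF y (hAΩ hy)))
    (Eventually.of_forall fun i => (hL i).dist_le_mul x hx y hy)

end LocLipOn

theorem exists_abs_Pnu_le {m : ℕ} {K : Euc m → Matrix (Fin m) (Fin m) ℝ} {A : Set (Euc m)}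
    (hA : IsCompact A) (hK : ∀ i j, ContinuousOn (fun x => K x i j) A) :
    ∃ C, ∀ x ∈ A, ∀ ν : Euc m → Euc m, ‖ν x‖ = 1 → |Pnu K ν x| ≤ C := by
  have hcont : ContinuousOn (fun x => ∑ i, |K x i i| + ∑ i, ∑ j, |K x i j|) A := by
    refine (continuousOn_finsetSum _ fun i _ => (hK i i).abs).add
      (continuousOn_finsetSum _ fun i _ => continuousOn_finsetSum _ fun j _ => (hK i j).abs)
  obtain ⟨C, hC⟩ := hA.exists_bound_of_continuousOn hcont
  refine ⟨C, fun x hx ν hν => ?_⟩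
  refine le_trans ?_ ((le_abs_self _).trans (hC x hx))
  have hcoord : ∀ i, |ν x i| ≤ 1 := fun i => by
    simpa [hν] using PiLp.norm_apply_le (ν x) i
  refine (abs_sub _ _).trans (add_le_add ?_ ?_)
  · exact Finset.abs_sum_le_sum_abs _ _
  · refine (Finset.abs_sum_le_sum_abs _ _).trans (Finset.sum_le_sum fun i _ => ?_)
    refine (Finset.abs_sum_le_sum_abs _ _).trans (Finset.sum_le_sum fun j _ => ?_)
    rw [abs_mul, abs_mul]
    calc |ν x i| * |K x i j| * |ν x j| ≤ 1 * |K x i j| * 1 := by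
          gcongr
          exacts [hcoord i, hcoord j]
      _ = |K x i j| := by ring

theorem abs_Bulk_le {m : ℕ} (K : Euc m → Matrix (Fin m) (Fin m) ℝ) (u : Euc m → ℝ)
    (ν : Euc m → Euc m) (x : Euc m) : |Bulk K u ν x| ≤ ‖gradient u x‖ + |Pnu K ν x| := by
  rw [Bulk, abs_of_nonneg (Real.sqrt_nonneg _)]
  refine Real.sqrt_le_iff.2 ⟨by positivity, ?_⟩
  have h := mul_nonneg (norm_nonneg (gradient u x)) (abs_nonneg (Pnu K ν x))
  nlinarith [sq_abs (Pnu K ν x)]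

theorem aestronglyMeasurable_Bulk {m : ℕ} {K : Euc m → Matrix (Fin m) (Fin m) ℝ}
    {A : Set (Euc m)} (hA : MeasurableSet A) (hK : ∀ i j, ContinuousOn (fun x => K x i j) A)
    (u : Euc m → ℝ) {ν : Euc m → Euc m} (hν : Measurable ν) :
    AEStronglyMeasurable (Bulk K u ν) (volume.restrict A) := by
  have hK' : ∀ i j, AEMeasurable (fun x => K x i j) (volume.restrict A) := fun i j =>
    ((hK i j).aestronglyMeasurable hA).aemeasurable
  have hν' : ∀ i, Measurable fun x => ν x i := fun i => by fun_prop
  have hP : AEMeasurable (Pnu K ν) (volume.restrict A) := by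
    refine AEMeasurable.sub (Finset.aemeasurable_fun_sum _ fun i _ => hK' i i) ?_
    exact Finset.aemeasurable_fun_sum _ fun i _ => Finset.aemeasurable_fun_sum _ fun j _ =>
      ((hν' i).aemeasurable.mul (hK' i j)).mul (hν' j).aemeasurable
  exact ((((measurable_norm_gradient u).pow_const 2).aemeasurable.add
    (hP.pow_const 2)).sqrt).aestronglyMeasurable

theorem tendsto_Bulk {m : ℕ} {K : Euc m → Matrix (Fin m) (Fin m) ℝ} {ι : Type*} {l : Filter ι}
    {u : ι → Euc m → ℝ} {u₀ : Euc m → ℝ} {ν : ι → Euc m → Euc m} {ν₀ : Euc m → Euc m} {x : Euc m}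
    (hu : Tendsto (fun i => ‖gradient (u i) x‖) l (𝓝 ‖gradient u₀ x‖))
    (hν : Tendsto (fun i => ν i x) l (𝓝 (ν₀ x))) :
    Tendsto (fun i => Bulk K (u i) (ν i) x) l (𝓝 (Bulk K u₀ ν₀ x)) := by
  have hcoord : ∀ k, Tendsto (fun i => ν i x k) l (𝓝 (ν₀ x k)) := fun k =>
    ((EuclideanSpace.proj (𝕜 := ℝ) k).continuous.tendsto (ν₀ x)).comp hν
  have hP : Tendsto (fun i => Pnu K (ν i) x) l (𝓝 (Pnu K ν₀ x)) :=
    tendsto_const_nhds.sub (tendsto_finsetSum _ fun i _ => tendsto_finsetSum _ fun j _ =>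
      ((hcoord i).mul tendsto_const_nhds).mul (hcoord j))
  exact ((hu.pow 2).add (hP.pow 2)).sqrt

theorem integrableOn_norm_gradient_add_mul_Bulk {m : ℕ} {Ω A : Set (Euc m)} (hΩ : IsOpen Ω)
    (hA : IsCompact A) (hAΩ : A ⊆ Ω) {K : Euc m → Matrix (Fin m) (Fin m) ℝ}
    (hK : ∀ i j, ContinuousOn (fun x => K x i j) Ω) {u v : Euc m → ℝ} {ν : Euc m → Euc m}
    (hu : LocLipOn Ω u) (hv : LocLipOn Ω v) (hν : Measurable ν)
    (hν1 : ∀ᵐ x : Euc m, x ∈ Ω → ‖ν x‖ = 1) :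
    IntegrableOn (fun x => ‖gradient v x‖ + v x * Bulk K u ν x) A := by
  have hK' : ∀ i j, ContinuousOn (fun x => K x i j) A := fun i j => (hK i j).mono hAΩ
  obtain ⟨P, hP⟩ := exists_abs_Pnu_le hA hK'
  obtain ⟨M, hM0, hM⟩ := hv.exists_abs_le hA hAΩ
  obtain ⟨Lu, hLu⟩ := hu.exists_norm_gradient_le hΩ hA hAΩ
  obtain ⟨Lv, hLv⟩ := hv.exists_norm_gradient_le hΩ hA hAΩ
  refine IntegrableOn.of_bound hA.measure_lt_top ?_ (Lv + M * (Lu + P)) ?_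
  · exact (measurable_norm_gradient v).aestronglyMeasurable.add
      ((hv.aestronglyMeasurable hA hAΩ).mul (aestronglyMeasurable_Bulk hA.measurableSet hK' u hν))
  · filter_upwards [ae_restrict_of_ae hν1, ae_restrict_mem hA.measurableSet] with x hx hxA
    rw [Real.norm_eq_abs]
    refine (abs_add_le _ _).trans (add_le_add ?_ ?_)
    · rw [abs_norm]; exact hLv x hxA
    · rw [abs_mul]
      exact mul_le_mul (hM x hxA) ((abs_Bulk_le K u ν x).trans
        (add_le_add (hLu x hxA) (hP x hxA ν (hx (hAΩ hxA))))) (abs_nonneg _) hM0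

theorem norm_gradient_interpolation_le {m : ℕ} {φ u v : Euc m → ℝ} {x : Euc m}
    (hφ : DifferentiableAt ℝ φ x) (hu : DifferentiableAt ℝ u x) (hv : DifferentiableAt ℝ v x)
    (h0 : 0 ≤ φ x) (h1 : φ x ≤ 1) :
    ‖gradient (fun y => u y + φ y * (v y - u y)) x‖ ≤
      (1 - φ x) * ‖gradient u x‖ + φ x * ‖gradient v x‖ + |v x - u x| * ‖gradient φ x‖ := by
  simp_rw [norm_gradient_eq_norm_fderiv]
  have h : fderiv ℝ (fun y => u y + φ y * (v y - u y)) x =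
      (1 - φ x) • fderiv ℝ u x + φ x • fderiv ℝ v x + (v x - u x) • fderiv ℝ φ x := by
    refine (hu.hasFDerivAt.add (hφ.hasFDerivAt.mul
      (hv.hasFDerivAt.sub hu.hasFDerivAt))).fderiv.trans ?_
    simp only [Pi.sub_apply]
    module
  rw [h]
  refine norm_add₃_le.trans ?_
  simp only [norm_smul, Real.norm_eq_abs, abs_of_nonneg h0, abs_of_nonneg (sub_nonneg.2 h1)]
  exact le_rfl

theorem exists_contDiff_cutoff {m : ℕ} {A A' : Set (Euc m)} (hA : IsCompact A)
    (hAA' : A ⊆ interior A') :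
    ∃ φ : Euc m → ℝ, ContDiff ℝ 1 φ ∧ (∀ x, 0 ≤ φ x ∧ φ x ≤ 1) ∧ (∀ x ∈ A, φ x = 1) ∧
      (∀ x ∉ interior A', φ x = 0) ∧ ∀ x ∈ A, gradient φ x = 0 := by
  obtain ⟨φ, h0, h1, h01⟩ := exists_contMDiffMap_zero_one_of_isClosed (n := 1)
    (modelWithCornersSelf ℝ (Euc m)) (isOpen_interior (s := A')).isClosed_compl hA.isClosed
    (disjoint_compl_left_iff_subset.2 hAA')
  have hA1 : ∀ x ∈ A, φ x = 1 := fun x hx => h1 hx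
  refine ⟨φ, φ.contMDiff.contDiff, h01, hA1, fun x hx => h0 hx, fun x hx => ?_⟩
  have hmax : IsLocalMax φ x := Eventually.of_forall fun y => by
    rw [hA1 x hx]; exact (h01 y).2
  rw [gradient, hmax.fderiv_eq_zero, map_zero]

theorem ContDiff.locLipOn {m : ℕ} {f : Euc m → ℝ} (hf : ContDiff ℝ 1 f) (Ω : Set (Euc m)) :
    LocLipOn Ω f := by
  intro A hA _
  exact (hf.locallyLipschitz.locallyLipschitzOn).exists_lipschitzOnWith_of_compact hA

theorem exists_seq_tendsto_ae_of_tendsto_integral_abs_sub {α : Type*} [MeasurableSpace α]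
    {μ : Measure α} {f : ℕ → α → ℝ} {g : α → ℝ} (hf : ∀ i, Integrable (f i) μ)
    (hg : Integrable g μ) (h : Tendsto (fun i => ∫ x, |f i x - g x| ∂μ) atTop (𝓝 0)) :
    ∃ ns : ℕ → ℕ, StrictMono ns ∧ ∀ᵐ x ∂μ, Tendsto (fun i => f (ns i) x) atTop (𝓝 (g x)) := by
  refine (tendstoInMeasure_of_tendsto_eLpNorm one_ne_zero (fun i => (hf i).1) hg.1
    ?_).exists_seq_tendsto_ae
  have h' := ENNReal.tendsto_ofReal h
  rw [ENNReal.ofReal_zero] at h'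
  refine h'.congr fun i => ?_
  rw [eLpNorm_one_eq_lintegral_enorm, ← ofReal_integral_norm_eq_lintegral_enorm ((hf i).sub hg)]
  rfl

/-- The integrand comparing `J` at `u` with `J` at the interpolation `u + φ (v - u)`. -/
def cutoffDefect {m : ℕ} (B φ u v : Euc m → ℝ) (x : Euc m) : ℝ :=
  φ x * (‖gradient v x‖ - ‖gradient u x‖) + |v x - u x| * ‖gradient φ x‖ +
    φ x * (v x - u x) * B x

theorem abs_cutoffDefect_le {m : ℕ} (B u v : Euc m → ℝ) {φ : Euc m → ℝ} {x : Euc m}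
    (h0 : 0 ≤ φ x) (h1 : φ x ≤ 1) :
    |cutoffDefect B φ u v x| ≤
      ‖gradient v x‖ + ‖gradient u x‖ + |v x - u x| * (‖gradient φ x‖ + |B x|) := by
  have hφ : |φ x| ≤ 1 := abs_le.2 ⟨by linarith, h1⟩
  have h₁ : |φ x * (‖gradient v x‖ - ‖gradient u x‖)| ≤ ‖gradient v x‖ + ‖gradient u x‖ := by
    rw [abs_mul]
    have := abs_sub ‖gradient v x‖ ‖gradient u x‖
    rw [abs_norm, abs_norm] at this
    exact (mul_le_of_le_one_left (abs_nonneg _) hφ).trans this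
  have h₂ : |φ x * (v x - u x) * B x| ≤ |v x - u x| * |B x| := by
    rw [mul_assoc, abs_mul, ← abs_mul (v x - u x)]
    exact mul_le_of_le_one_left (abs_nonneg _) hφ
  refine (abs_add_three _ _ _).trans ?_
  rw [abs_of_nonneg (mul_nonneg (abs_nonneg (v x - u x)) (norm_nonneg (gradient φ x)))]
  linarith

theorem aestronglyMeasurable_cutoffDefect {m : ℕ} {Ω A : Set (Euc m)} (hA : IsCompact A)
    (hAΩ : A ⊆ Ω) {B φ u v : Euc m → ℝ} (hB : AEStronglyMeasurable B (volume.restrict A))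
    (hφ : LocLipOn Ω φ) (hu : LocLipOn Ω u) (hv : LocLipOn Ω v) :
    AEStronglyMeasurable (cutoffDefect B φ u v) (volume.restrict A) := by
  have hφ' := hφ.aestronglyMeasurable hA hAΩ
  have hw := (hv.sub hu).aestronglyMeasurable hA hAΩ
  exact ((hφ'.mul (((measurable_norm_gradient v).sub
    (measurable_norm_gradient u)).aestronglyMeasurable)).add
    (hw.norm.mul (measurable_norm_gradient φ).aestronglyMeasurable)).add ((hφ'.mul hw).mul hB)

theorem IsWeakSol.setIntegral_cutoffDefect_nonneg {m : ℕ} {Ω A : Set (Euc m)} (hΩ : IsOpen Ω)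
    (hA : IsCompact A) (hAΩ : A ⊆ Ω) {K : Euc m → Matrix (Fin m) (Fin m) ℝ}
    (hK : ∀ i j, ContinuousOn (fun x => K x i j) Ω) {φ u v : Euc m → ℝ} {ν : Euc m → Euc m}
    (hsol : IsWeakSol Ω (Bulk K u ν) u) (hu : LocLipOn Ω u) (hv : LocLipOn Ω v)
    (hν : Measurable ν) (hν1 : ∀ᵐ x : Euc m, x ∈ Ω → ‖ν x‖ = 1) (hφ : ContDiff ℝ 1 φ)
    (hφ01 : ∀ x, 0 ≤ φ x ∧ φ x ≤ 1) (hφA : ∀ x ∉ interior A, φ x = 0)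
    (hint : IntegrableOn (cutoffDefect (Bulk K u ν) φ u v) A) :
    0 ≤ ∫ x in A, cutoffDefect (Bulk K u ν) φ u v x := by
  set w : Euc m → ℝ := fun y => u y + φ y * (v y - u y) with hw
  have hwLip : LocLipOn Ω w := hu.add ((hφ.locLipOn Ω).mul (hv.sub hu))
  have hwu : {x | w x ≠ u x} ⊆ interior A := fun x hx => by
    by_contra hxA
    exact hx (by simp [hw, hφA x hxA])
  have hJ := hsol A hA hAΩ w hwLip hwu
  have hiu := integrableOn_norm_gradient_add_mul_Bulk hΩ hA hAΩ hK hu hu hν hν1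
  have hiw := integrableOn_norm_gradient_add_mul_Bulk hΩ hA hAΩ hK hu hwLip hν hν1
  refine (sub_nonneg.2 hJ).trans ?_
  rw [Jfun, Jfun, ← integral_sub hiw hiu]
  refine integral_mono_ae (hiw.sub hiu) hint ?_
  filter_upwards [ae_restrict_of_ae (hu.ae_differentiableAt hΩ hA hAΩ),
    ae_restrict_of_ae (hv.ae_differentiableAt hΩ hA hAΩ),
    ae_restrict_mem hA.measurableSet] with x hux hvx hxA
  have h := norm_gradient_interpolation_le ((hφ.differentiable one_ne_zero) x) (hux hxA) (hvx hxA)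
    (hφ01 x).1 (hφ01 x).2
  simp only [cutoffDefect, hw] at h ⊢
  linarith

theorem gradient_eq_of_notMem {m : ℕ} {A : Set (Euc m)} (hA : IsClosed A) {u v : Euc m → ℝ}
    (h : ∀ x ∉ A, v x = u x) {x : Euc m} (hx : x ∉ A) : gradient v x = gradient u x := by
  have : v =ᶠ[𝓝 x] u := by
    filter_upwards [hA.isOpen_compl.mem_nhds hx] with y hy using h y hy
  rw [gradient, gradient, this.fderiv_eq]

/-- **Compactness Theorem** (Euclidean background version of Theorem 6.6):
limits of weak solutions of the variational principle for inverse space-time mean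
curvature flow are weak solutions. -/
theorem compactness_of_weak_solutions
    {d : ℕ} (hd : 1 ≤ d) {Ω : Set (Euc d)} (hΩ : IsOpen Ω)
    (K : Euc d → Matrix (Fin d) (Fin d) ℝ)
    (hKsymm : ∀ x ∈ Ω, (K x).IsSymm)
    (hKcont : ∀ i j, ContinuousOn (fun x => K x i j) Ω)
    (Ui : ℕ → Euc d → ℝ) (νi : ℕ → Euc d → Euc d) (U : Euc d → ℝ) (ν : Euc d → Euc d)
    (hUiLip : ∀ i, LocLipOn Ω (Ui i))
    (hνimeas : ∀ i, Measurable (νi i))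
    (hνiunit : ∀ i, ∀ᵐ x : Euc d, x ∈ Ω → ‖νi i x‖ = 1)
    (hUisol : ∀ i, IsWeakSol Ω (Bulk K (Ui i) (νi i)) (Ui i))
    -- (a) locally uniform convergence and uniform local Lipschitz bounds
    (hUconv : TendstoLocallyUniformlyOn Ui U atTop Ω)
    (hUnifLip : ∀ A : Set (Euc d), IsCompact A → A ⊆ Ω →
      ∃ L : NNReal, ∀ i, LipschitzOnWith L (Ui i) A)
    -- (b) a.e. convergence of the unit vector fields
    (hνmeas : Measurable ν)
    (hνunit : ∀ᵐ x : Euc d, x ∈ Ω → ‖ν x‖ = 1)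
    (hνconv : ∀ᵐ x : Euc d, x ∈ Ω → Tendsto (fun i => νi i x) atTop (𝓝 (ν x)))
    -- (c) `‖∇U_i‖ → ‖∇U‖` in `L¹_loc(Ω)`
    (hL1 : ∀ A : Set (Euc d), IsCompact A → A ⊆ Ω →
      Tendsto (fun i => ∫ x in A, |‖gradient (Ui i) x‖ - ‖gradient U x‖|) atTop (𝓝 0)) :
    LocLipOn Ω U ∧ IsWeakSol Ω (Bulk K U ν) U := by
  have hpt : ∀ x ∈ Ω, Tendsto (fun i => Ui i x) atTop (𝓝 (U x)) := fun x hx =>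
    hUconv.tendsto_at hx
  have hULip : LocLipOn Ω U := LocLipOn.of_tendsto hpt hUnifLip
  refine ⟨hULip, fun A hA hAΩ v hv hvU => ?_⟩
  obtain ⟨A₁, hA₁, hAA₁, hA₁Ω⟩ := exists_compact_between hA hΩ hAΩ
  obtain ⟨A₂, hA₂, hA₁A₂, hA₂Ω⟩ := exists_compact_between hA₁ hΩ hA₁Ω
  obtain ⟨φ, hφ, hφ01, hφ1, hφ0, hφgrad⟩ := exists_contDiff_cutoff hA hAA₁
  have hφLip := hφ.locLipOn Ω
  have hK₁ : ∀ i j, ContinuousOn (fun x => K x i j) A₁ := fun i j => (hKcont i j).mono hA₁Ω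
  obtain ⟨L, hL⟩ := hUnifLip A₂ hA₂ hA₂Ω
  have hgrad : ∀ i, ∀ x ∈ A₁, ‖gradient (Ui i) x‖ ≤ L := fun i x hx =>
    norm_gradient_le_of_lipschitzOn (hL i) (mem_interior_iff_mem_nhds.1 (hA₁A₂ hx))
  obtain ⟨P, hP⟩ := exists_abs_Pnu_le hA₁ hK₁
  obtain ⟨Lv, hLv⟩ := hv.exists_norm_gradient_le hΩ hA₁ hA₁Ω
  obtain ⟨Lφ, hLφ⟩ := hφLip.exists_norm_gradient_le hΩ hA₁ hA₁Ω
  have hBmeas : ∀ i, AEStronglyMeasurable (Bulk K (Ui i) (νi i)) (volume.restrict A₁) := fun i =>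
    aestronglyMeasurable_Bulk hA₁.measurableSet hK₁ (Ui i) (hνimeas i)
  have hFmeas : ∀ i, AEStronglyMeasurable (cutoffDefect (Bulk K (Ui i) (νi i)) φ (Ui i) v)
      (volume.restrict A₁) := fun i =>
    aestronglyMeasurable_cutoffDefect hA₁ hA₁Ω (hBmeas i) hφLip (hUiLip i) hv
  have hFbound : ∀ i (M : ℝ), (∀ x ∈ A₁, |v x - Ui i x| ≤ M) → ∀ᵐ x ∂volume.restrict A₁,
      ‖cutoffDefect (Bulk K (Ui i) (νi i)) φ (Ui i) v x‖ ≤ Lv + L + M * (Lφ + (L + P)) := by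
    intro i M hM
    filter_upwards [ae_restrict_of_ae (hνiunit i), ae_restrict_mem hA₁.measurableSet] with x hx hxA
    refine (abs_cutoffDefect_le _ _ _ (hφ01 x).1 (hφ01 x).2).trans ?_
    have hM0 : 0 ≤ M := (abs_nonneg _).trans (hM x hxA)
    gcongr
    · exact hLv x hxA
    · exact hgrad i x hxA
    · exact hM x hxA
    · exact hLφ x hxA
    · exact (abs_Bulk_le K _ _ x).trans (add_le_add (hgrad i x hxA) (hP x hxA _ (hx (hA₁Ω hxA))))
  have hFnonneg : ∀ i, 0 ≤ ∫ x in A₁, cutoffDefect (Bulk K (Ui i) (νi i)) φ (Ui i) v x := by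
    intro i
    obtain ⟨M, -, hM⟩ := (hv.sub (hUiLip i)).exists_abs_le hA₁ hA₁Ω
    exact (hUisol i).setIntegral_cutoffDefect_nonneg hΩ hA₁ hA₁Ω hKcont (hUiLip i) hv (hνimeas i)
      (hνiunit i) hφ hφ01 hφ0
      (IntegrableOn.of_bound hA₁.measure_lt_top (hFmeas i) _ (hFbound i M hM))
  obtain ⟨M, -, hM⟩ := (hv.sub hULip).exists_abs_le hA₁ hA₁Ω
  have hunif : ∀ᶠ i in atTop, ∀ x ∈ A₁, |v x - Ui i x| ≤ M + 1 := by
    have h := (tendstoLocallyUniformlyOn_iff_forall_isCompact hΩ).1 hUconv A₁ hA₁Ω hA₁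
    filter_upwards [Metric.tendstoUniformlyOn_iff.1 h 1 one_pos] with i hi x hx
    have h₁ := (hi x hx).le
    rw [Real.dist_eq] at h₁
    calc |v x - Ui i x| = |(v x - U x) + (U x - Ui i x)| := by ring_nf
      _ ≤ M + 1 := (abs_add_le _ _).trans (add_le_add (hM x hx) h₁)
  have hint : ∀ u, LocLipOn Ω u → IntegrableOn (fun x => ‖gradient u x‖) A₁ := fun u hu => by
    obtain ⟨C, hC⟩ := hu.exists_norm_gradient_le hΩ hA₁ hA₁Ω
    refine IntegrableOn.of_bound hA₁.measure_lt_top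
      (measurable_norm_gradient u).aestronglyMeasurable C ?_
    filter_upwards [ae_restrict_mem hA₁.measurableSet] with x hx
    rw [norm_norm]
    exact hC x hx
  obtain ⟨ns, hns, hgradconv⟩ := exists_seq_tendsto_ae_of_tendsto_integral_abs_sub
    (fun i => hint (Ui i) (hUiLip i)) (hint U hULip) (hL1 A₁ hA₁ hA₁Ω)
  have hlim : Tendsto (fun i => ∫ x in A₁,
        cutoffDefect (Bulk K (Ui (ns i)) (νi (ns i))) φ (Ui (ns i)) v x) atTop
      (𝓝 (∫ x in A₁, cutoffDefect (Bulk K U ν) φ U v x)) := by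
    refine tendsto_integral_filter_of_dominated_convergence
      (fun _ => Lv + L + (M + 1) * (Lφ + (L + P))) (Eventually.of_forall fun i => hFmeas (ns i))
      ((hns.tendsto_atTop.eventually hunif).mono fun i hi => hFbound (ns i) (M + 1) hi)
      (integrableOn_const hA₁.measure_lt_top.ne) ?_
    filter_upwards [hgradconv, ae_restrict_of_ae hνconv, ae_restrict_mem hA₁.measurableSet]
      with x hgx hνx hxA
    have hB := tendsto_Bulk (K := K) (u := fun i => Ui (ns i)) (ν := fun i => νi (ns i)) hgx
      ((hνx (hA₁Ω hxA)).comp hns.tendsto_atTop)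
    have hw := ((hpt x (hA₁Ω hxA)).comp hns.tendsto_atTop).const_sub (v x)
    exact (((hgx.const_sub _).const_mul _).add (hw.abs.mul_const _)).add ((hw.const_mul _).mul hB)
  have hnonneg := ge_of_tendsto' hlim fun i => hFnonneg (ns i)
  have hvU' : ∀ x ∉ A, v x = U x := fun x hx => by
    by_contra hne
    exact hx (interior_subset (hvU hne))
  rw [setIntegral_eq_of_subset_of_forall_sdiff_eq_zero hA₁.measurableSet
    (hAA₁.trans interior_subset) fun x hx => by
      simp [cutoffDefect, hvU' x hx.2, gradient_eq_of_notMem hA.isClosed hvU' hx.2]] at hnonneg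
  rw [← sub_nonneg, Jfun, Jfun, ← integral_sub
    (integrableOn_norm_gradient_add_mul_Bulk hΩ hA hAΩ hKcont hULip hv hνmeas hνunit)
    (integrableOn_norm_gradient_add_mul_Bulk hΩ hA hAΩ hKcont hULip hULip hνmeas hνunit)]
  refine hnonneg.trans_eq (setIntegral_congr_fun hA.measurableSet fun x hx => ?_)
  simp only [cutoffDefect, hφ1 x hx, hφgrad x hx, norm_zero]
  ring
end
end

section
/- Let d ≥ 1, let Ω ⊆ ℝ^d be open, let K : Ω → Sym_d(ℝ) be a continuous field of symmetric d×d real matrices, and let u : Ω → ℝ be of class C² with ∇u(x) ≠ 0 for every x ∈ Ω. Set ν(x) := ∇u(x)/‖∇u(x)‖, P(x) := tr K(x) − ⟨ν(x), K(x)ν(x)⟩, and B(x) := √(‖∇u(x)‖² + P(x)²), and suppose u satisfies the level-set equation div ν(x) = B(x) for all x ∈ Ω, where div ν := ∑_{i=1}^d ∂_i ν_i. Then u is a weak solution with bulk term B on Ω: for every compact A ⊆ Ω and every locally Lipschitz v : Ω → ℝ with {x : v(x) ≠ u(x)} contained in the interior of A, one has ∫_A (‖∇u‖ + u·B) dx ≤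 ∫_A (‖∇v‖ + v·B) dx. -/
open MeasureTheory Set Filter Topology
noncomputable section

/-- Divergence `div X = ∑ᵢ ∂ᵢ Xᵢ` of a vector field, via `fderiv`. -/
noncomputable def divVF {m : ℕ} (X : Euc m → Euc m) (x : Euc m) : ℝ :=
  ∑ i, fderiv ℝ (fun y => X y i) x (EuclideanSpace.single i 1)

open scoped InnerProductSpace NNReal Manifold

/-- A locally Lipschitz function with compact support is globally Lipschitz. -/
theorem LocallyLipschitz.exists_lipschitzWith_of_hasCompactSupport {E : Type*} [MetricSpace E]
    [LocallyCompactSpace E] {w : E → ℝ} (hw : LocallyLipschitz w) (hc : HasCompactSupport w) :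
    ∃ C, LipschitzWith C w := by
  obtain ⟨δ, hδ, hK⟩ := IsCompact.exists_isCompact_cthickening hc
  obtain ⟨L, hL⟩ := (hw.locallyLipschitzOn (s := Metric.cthickening δ (tsupport w)))
    |>.exists_lipschitzOnWith_of_compact hK
  obtain ⟨M, hM⟩ := hc.exists_bound_of_continuous hw.continuous
  have hsub : tsupport w ⊆ Metric.cthickening δ (tsupport w) :=
    Metric.self_subset_cthickening _
  have key : ∀ x ∈ tsupport w, ∀ y, dist (w x) (w y) ≤ max (L : ℝ) (M / δ) * dist x y := by
    intro x hx y
    by_cases hy : y ∈ Metric.cthickening δ (tsupport w)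
    · exact (hL.dist_le_mul x (hsub hx) y hy).trans (by gcongr; exact le_max_left _ _)
    · have hwy : w y = 0 := image_eq_zero_of_notMem_tsupport fun h ↦ hy (hsub h)
      have hd : δ ≤ dist x y := by
        by_contra! h
        exact hy (Metric.mem_cthickening_of_dist_le y x δ _ hx (by rw [dist_comm]; exact h.le))
      have hM0 : 0 ≤ M := (norm_nonneg _).trans (hM x)
      calc dist (w x) (w y) = ‖w x‖ := by simp [hwy]
        _ ≤ M / δ * δ := by rw [div_mul_cancel₀ _ hδ.ne']; exact hM x
        _ ≤ max (L : ℝ) (M / δ) * dist x y := by gcongr; exact le_max_right _ _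
  refine ⟨⟨max (L : ℝ) (M / δ), le_max_of_le_left L.2⟩, LipschitzWith.of_dist_le_mul fun x y ↦ ?_⟩
  by_cases hx : x ∈ tsupport w
  · exact key x hx y
  by_cases hy : y ∈ tsupport w
  · rw [dist_comm, dist_comm x]
    exact key y hy x
  · rw [image_eq_zero_of_notMem_tsupport hx, image_eq_zero_of_notMem_tsupport hy, dist_self]
    exact mul_nonneg (le_max_of_le_left L.2) dist_nonneg

/-- A compact subset of an open set admits a compactly supported smooth cutoff function. -/
theorem IsCompact.exists_contDiff_one_nhdsSet {m : ℕ} {S Ω : Set (Euc m)} (hS : IsCompact S)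
    (hΩ : IsOpen Ω) (h : S ⊆ Ω) :
    ∃ η : Euc m → ℝ, ContDiff ℝ 1 η ∧ HasCompactSupport η ∧ tsupport η ⊆ Ω ∧
      ∀ x ∈ S, η =ᶠ[𝓝 x] 1 := by
  obtain ⟨T, hT, hST, hTΩ⟩ := exists_compact_between hS hΩ h
  obtain ⟨η, h1, h0, -⟩ := exists_contMDiffMap_one_nhds_of_subset_interior (n := 1)
    𝓘(ℝ, Euc m) hS.isClosed hST
  have hsupp : tsupport η ⊆ T :=
    closure_minimal (fun x hx ↦ by_contra fun hxT ↦ hx (h0 x hxT)) hT.isClosed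
  refine ⟨η, η.contMDiff.contDiff, hT.of_isClosed_subset (isClosed_tsupport _) hsupp,
    hsupp.trans hTΩ, fun x hx ↦ ?_⟩
  exact h1.filter_mono (nhds_le_nhdsSet hx)

/-- Integration by parts for a compactly supported Lipschitz function against a `C¹` function
defined on a neighbourhood of its support. -/
theorem LipschitzWith.integral_fderiv_mul_add_mul_fderiv {m : ℕ} {Ω : Set (Euc m)}
    (hΩ : IsOpen Ω) {C : ℝ≥0} {w : Euc m → ℝ} (hw : LipschitzWith C w)
    (hc : HasCompactSupport w) (hsub : tsupport w ⊆ Ω) {f : Euc m → ℝ}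
    (hf : ContDiffOn ℝ 1 f Ω) (e : Euc m) :
    Integrable (fun x ↦ fderiv ℝ w x e * f x + w x * fderiv ℝ f x e) ∧
      ∫ x, (fderiv ℝ w x e * f x + w x * fderiv ℝ f x e) = 0 := by
  obtain ⟨η, hη, hηc, hηΩ, hη1⟩ := IsCompact.exists_contDiff_one_nhdsSet hc hΩ hsub
  set φ : Euc m → ℝ := fun x ↦ η x * f x with hφ
  have hφc : HasCompactSupport φ := hηc.mul_right
  have hφd : ContDiff ℝ 1 φ := by
    rw [contDiff_iff_contDiffAt]
    intro x
    by_cases hx : x ∈ tsupport η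
    · exact hη.contDiffAt.mul (hf.contDiffAt (hΩ.mem_nhds (hηΩ hx)))
    · have : φ =ᶠ[𝓝 x] fun _ ↦ 0 := by
        filter_upwards [notMem_tsupport_iff_eventuallyEq.1 hx] with y hy
        simp [hφ, hy]
      exact contDiffAt_const.congr_of_eventuallyEq this
  obtain ⟨D, hφL⟩ := hφd.lipschitzWith_of_hasCompactSupport hφc one_ne_zero
  have hline : ∀ᵐ x, lineDeriv ℝ w x e = fderiv ℝ w x e := by
    filter_upwards [hw.ae_differentiableAt (μ := volume)] with x hx
    exact hx.lineDeriv_eq_fderiv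
  have heq : (fun x ↦ fderiv ℝ w x e * f x + w x * fderiv ℝ f x e) =
      fun x ↦ fderiv ℝ w x e * φ x + fderiv ℝ φ x e * w x := by
    ext x
    by_cases hx : x ∈ tsupport w
    · have : φ =ᶠ[𝓝 x] f := by
        filter_upwards [hη1 x hx] with y hy
        simp [hφ, hy]
      rw [this.fderiv_eq, this.self_of_nhds]
      ring
    · have hx' := notMem_tsupport_iff_eventuallyEq.1 hx
      rw [hx'.fderiv_eq, hx'.self_of_nhds]
      simp
  have hint1 : Integrable (fun x ↦ fderiv ℝ w x e * φ x) := by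
    have := (hφd.continuous.integrable_of_hasCompactSupport (μ := volume) hφc).bdd_mul
      (c := C * ‖e‖) (measurable_fderiv_apply_const ℝ w e).aestronglyMeasurable
      (.of_forall fun x ↦ ?_)
    · exact this
    · exact (ContinuousLinearMap.le_opNorm _ _).trans
        (by gcongr; exact norm_fderiv_le_of_lipschitz ℝ hw)
  have hcont : Continuous fun x ↦ fderiv ℝ φ x e :=
    (hφd.continuous_fderiv one_ne_zero).clm_apply continuous_const
  have hint2 : Integrable (fun x ↦ fderiv ℝ φ x e * w x) :=
    (hcont.mul hw.continuous).integrable_of_hasCompactSupport hc.mul_left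
  rw [heq]
  refine ⟨hint1.add hint2, ?_⟩
  rw [integral_add hint1 hint2]
  have hparts := LipschitzWith.integral_lineDeriv_mul_eq (μ := volume) hw hφL hφc e
  have h1 : ∫ x, lineDeriv ℝ w x e * φ x = ∫ x, fderiv ℝ w x e * φ x :=
    integral_congr_ae (by filter_upwards [hline] with x hx; rw [hx])
  have h2 : ∫ x, lineDeriv ℝ φ x (-e) * w x = -∫ x, fderiv ℝ φ x e * w x := by
    rw [← integral_neg]
    congr 1 with x
    rw [(hφd.differentiable one_ne_zero x).lineDeriv_eq_fderiv]
    simp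
  linarith

/-- The divergence theorem for `w • X`, with `w` Lipschitz with compact support in `Ω` and `X`
of class `C¹` on `Ω`. -/
theorem LipschitzWith.integral_inner_gradient_add_mul_divVF {m : ℕ} {Ω : Set (Euc m)}
    (hΩ : IsOpen Ω) {C : ℝ≥0} {w : Euc m → ℝ} (hw : LipschitzWith C w)
    (hc : HasCompactSupport w) (hsub : tsupport w ⊆ Ω) {X : Euc m → Euc m}
    (hX : ContDiffOn ℝ 1 X Ω) :
    Integrable (fun x ↦ ⟪gradient w x, X x⟫_ℝ + w x * divVF X x) ∧
      ∫ x, (⟪gradient w x, X x⟫_ℝ + w x * divVF X x) = 0 := by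
  have hcoord : ∀ i, ContDiffOn ℝ 1 (fun x ↦ X x i) Ω := fun i ↦ (contDiffOn_euclidean.1 hX) i
  have hparts := fun i ↦ hw.integral_fderiv_mul_add_mul_fderiv hΩ hc hsub (hcoord i)
    (EuclideanSpace.single i 1)
  have heq : (fun x ↦ ⟪gradient w x, X x⟫_ℝ + w x * divVF X x) = fun x ↦ ∑ i,
      (fderiv ℝ w x (EuclideanSpace.single i 1) * X x i +
        w x * fderiv ℝ (fun y ↦ X y i) x (EuclideanSpace.single i 1)) := by
    ext x
    rw [Finset.sum_add_distrib, ← Finset.mul_sum, divVF]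
    congr 1
    rw [PiLp.inner_apply]
    refine Finset.sum_congr rfl fun i _ ↦ ?_
    rw [← inner_gradient_left, EuclideanSpace.inner_single_right]
    simp [mul_comm]
  rw [heq]
  refine ⟨integrable_finsetSum _ fun i _ ↦ (hparts i).1, ?_⟩
  rw [integral_finsetSum _ fun i _ ↦ (hparts i).1]
  exact Finset.sum_eq_zero fun i _ ↦ (hparts i).2

/-- The gradient of a `C²` function on an open set is `C¹`. -/
theorem ContDiffOn.gradient {m : ℕ} {Ω : Set (Euc m)} (hΩ : IsOpen Ω) {u : Euc m → ℝ}
    (hu : ContDiffOn ℝ 2 u Ω) : ContDiffOn ℝ 1 (gradient u) Ω :=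
  (InnerProductSpace.toDual ℝ (Euc m)).symm.contDiff.comp_contDiffOn
    (hu.fderiv_of_isOpen hΩ (by norm_num))

theorem measurable_gradient {m : ℕ} (v : Euc m → ℝ) : Measurable (gradient v) :=
  (InnerProductSpace.toDual ℝ (Euc m)).symm.continuous.measurable.comp (measurable_fderiv ℝ v)

theorem ContinuousOn.bulk {m : ℕ} {Ω : Set (Euc m)} {K : Euc m → Matrix (Fin m) (Fin m) ℝ}
    (hK : ∀ i j, ContinuousOn (fun x ↦ K x i j) Ω) {u : Euc m → ℝ}
    (hu : ContinuousOn (gradient u) Ω) {ν : Euc m → Euc m} (hν : ContinuousOn ν Ω) :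
    ContinuousOn (Bulk K u ν) Ω := by
  have hcoord : ∀ i, ContinuousOn (fun x ↦ ν x i) Ω := fun i ↦
    (EuclideanSpace.proj (𝕜 := ℝ) i).continuous.comp_continuousOn hν
  have hP : ContinuousOn (Pnu K ν) Ω := by
    refine ContinuousOn.sub ?_ ?_
    · exact continuousOn_finsetSum _ fun i _ ↦ hK i i
    · exact continuousOn_finsetSum _ fun i _ ↦ continuousOn_finsetSum _ fun j _ ↦
        ((hcoord i).mul (hK i j)).mul (hcoord j)
  exact ((hu.norm.pow 2).add (hP.pow 2)).sqrt

/-- A locally Lipschitz perturbation of a `C¹` function supported in a compact subset of `Ω`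
is globally Lipschitz. -/
theorem LocLipOn.exists_lipschitzWith_sub {m : ℕ} {Ω : Set (Euc m)} (hΩ : IsOpen Ω)
    {u v : Euc m → ℝ} (hu : ContDiffOn ℝ 1 u Ω) (hv : LocLipOn Ω v)
    (hc : HasCompactSupport (v - u)) (hsub : tsupport (v - u) ⊆ Ω) :
    ∃ C, LipschitzWith C (v - u) := by
  refine LocallyLipschitz.exists_lipschitzWith_of_hasCompactSupport (fun x ↦ ?_) hc
  by_cases hx : x ∈ tsupport (v - u)
  · obtain ⟨T, hT, hxT, hTΩ⟩ := exists_compact_subset hΩ (hsub hx)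
    obtain ⟨L, hL⟩ := hv T hT hTΩ
    obtain ⟨L', s, hs, hL'⟩ := (hu.contDiffAt (hΩ.mem_nhds (hsub hx))).exists_lipschitzOnWith
    exact ⟨L + L', T ∩ s, inter_mem (mem_interior_iff_mem_nhds.1 hxT) hs,
      (hL.mono inter_subset_left).sub (hL'.mono inter_subset_right)⟩
  · refine ⟨0, _, notMem_tsupport_iff_eventuallyEq.1 hx, ?_⟩
    intro y (hy : (v - u) y = 0) z (hz : (v - u) z = 0)
    simp [hy, hz, -Pi.sub_apply]

/-- **Smooth Flow Lemma** (Euclidean-background combination of Lemmas 6.2 and 6.3):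
a `C²` solution of the level-set equation `div(∇u/‖∇u‖) = √(‖∇u‖² + P²)` with
non-vanishing gradient is a weak solution of the variational principle. -/
theorem smooth_solutions_are_weak_solutions
    {d : ℕ} (hd : 1 ≤ d) {Ω : Set (Euc d)} (hΩ : IsOpen Ω)
    (K : Euc d → Matrix (Fin d) (Fin d) ℝ)
    (hKsymm : ∀ x ∈ Ω, (K x).IsSymm)
    (hKcont : ∀ i j, ContinuousOn (fun x => K x i j) Ω)
    (u : Euc d → ℝ) (hu : ContDiffOn ℝ 2 u Ω)
    (hugrad : ∀ x ∈ Ω, gradient u x ≠ 0)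
    (ν : Euc d → Euc d) (hν : ∀ x, ν x = ‖gradient u x‖⁻¹ • gradient u x)
    (hlevel : ∀ x ∈ Ω, divVF ν x = Bulk K u ν x) :
    IsWeakSol Ω (Bulk K u ν) u := by
  intro A hA hAΩ v hv hvA
  have hgrad : ContDiffOn ℝ 1 (gradient u) Ω := hu.gradient hΩ
  have hνC : ContDiffOn ℝ 1 ν Ω := by
    rw [show ν = _ from funext hν]
    exact ((hgrad.norm ℝ hugrad).inv fun x hx ↦ norm_ne_zero_iff.2 (hugrad x hx)).smul hgrad
  have hB : ContinuousOn (Bulk K u ν) A :=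
    (ContinuousOn.bulk hKcont hgrad.continuousOn hνC.continuousOn).mono hAΩ
  have hwA : tsupport (v - u) ⊆ A :=
    closure_minimal (fun x hx ↦ interior_subset (hvA (sub_ne_zero.1 hx))) hA.isClosed
  have hc : HasCompactSupport (v - u) := hA.of_isClosed_subset (isClosed_tsupport _) hwA
  have hsub := hwA.trans hAΩ
  obtain ⟨C, hw⟩ := hv.exists_lipschitzWith_sub hΩ (hu.of_le one_le_two) hc hsub
  obtain ⟨hdiv_int, hdiv⟩ := hw.integral_inner_gradient_add_mul_divVF hΩ hc hsub hνC
  have hdivA : ∫ x in A, (⟪gradient (v - u) x, ν x⟫_ℝ + (v - u) x * divVF ν x) = 0 := by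
    rw [setIntegral_eq_integral_of_forall_compl_eq_zero, hdiv]
    intro x hx
    have hx' := notMem_tsupport_iff_eventuallyEq.1 fun h ↦ hx (hwA h)
    have hx0 : (v - u) x = 0 := hx'.self_of_nhds
    have hg : gradient (v - u) x = 0 := by
      rw [hx'.gradient_eq]
      exact gradient_const x 0
    simp [hx0, hg]
  have hgradv : ∀ᵐ x ∂volume.restrict A, gradient v x = gradient (v - u) x + gradient u x := by
    filter_upwards [ae_restrict_of_ae (hw.ae_differentiableAt (μ := volume)),
      ae_restrict_mem hA.measurableSet] with x hx hxA
    have hux : DifferentiableAt ℝ u x :=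
      (hu.contDiffAt (hΩ.mem_nhds (hAΩ hxA))).differentiableAt two_ne_zero
    have := fderiv_add hx hux
    rw [sub_add_cancel] at this
    simp only [gradient, this, map_add]
  have hu_int : IntegrableOn (fun x ↦ ‖gradient u x‖ + u x * Bulk K u ν x) A :=
    ((hgrad.continuousOn.mono hAΩ).norm.add
      ((hu.continuousOn.mono hAΩ).mul hB)).integrableOn_compact hA
  have hgu_int : IntegrableOn (fun x ↦ C + ‖gradient u x‖) A :=
    (continuousOn_const.add (hgrad.continuousOn.mono hAΩ).norm).integrableOn_compact hA
  have hv_int : IntegrableOn (fun x ↦ ‖gradient v x‖ + v x * Bulk K u ν x) A := by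
    obtain ⟨L, hL⟩ := hv A hA hAΩ
    refine Integrable.add ?_ ((hL.continuousOn.mul hB).integrableOn_compact hA)
    refine hgu_int.mono' (measurable_gradient v).norm.aestronglyMeasurable ?_
    filter_upwards [hgradv] with x hx
    rw [norm_norm, hx]
    refine (norm_add_le _ _).trans ?_
    gcongr
    rw [gradient, LinearIsometryEquiv.norm_map]
    exact norm_fderiv_le_of_lipschitz ℝ hw
  rw [← sub_nonneg, Jfun, Jfun, ← integral_sub hv_int hu_int, ← hdivA]
  refine integral_mono_ae hdiv_int.integrableOn (hv_int.sub hu_int) ?_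
  filter_upwards [hgradv, ae_restrict_mem hA.measurableSet] with x hx hxA
  have hne : ‖gradient u x‖ ≠ 0 := norm_ne_zero_iff.2 (hugrad x (hAΩ hxA))
  have hνnorm : ‖ν x‖ = 1 := by
    rw [hν, norm_smul, norm_inv, norm_norm, inv_mul_cancel₀ hne]
  have huν : ⟪gradient u x, ν x⟫_ℝ = ‖gradient u x‖ := by
    rw [hν, real_inner_smul_right, real_inner_self_eq_norm_sq]
    field_simp
  have hvν : ⟪gradient v x, ν x⟫_ℝ ≤ ‖gradient v x‖ := by
    simpa [hνnorm] using real_inner_le_norm (gradient v x) (ν x)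
  have hsum : ⟪gradient v x, ν x⟫_ℝ =
      ⟪gradient (v - u) x, ν x⟫_ℝ + ⟪gradient u x, ν x⟫_ℝ := by rw [hx, inner_add_left]
  simp only [Pi.sub_apply, hlevel x (hAΩ hxA)]
  linarith
end
end
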